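/- Let p, n be positive integers, let ξ : ℝ^p → ℝ^n be twice continuously differentiable with Jacobian J(θ) (the Fréchet derivative of ξ at θ, viewed as a linear map ℝ^p → ℝ^n), and suppose there is θ* ∈ ℝ^p with ξ(θ*) = 0 and J(θ*) injective (full column rank). Fix a damping parameter γ ∈ (0,1) and define, wherever H(θ) := J(θ)ᵀ J(θ) is invertible, the damped Gauss–Newton map T_GN(θ) := θ − γ · H(θ)⁻¹ J(θ)ᵀ ξ(θ). Then there exist ε > 0 and ρ ∈ (0,1) such that: H(θ) is invertible for all θ in the closed ball B of radius ε around θ*, T_GN maps B into B, and for every C > 0 and every sequence (θ_k)_{k≥0} contained in B satisfying ‖θ_{k+1} − T_GN(θ_k)‖ ≤ C/(k+1) for all k ≥ 0, there exists C' > 0 with ‖θ_K − θ*‖ ≤ C'/K + ρ^K ‖θ_0 − θ*‖ for all K ≥ 1. -/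

import Mathlib

open ContinuousLinearMap

/-- The Gauss–Newton curvature `H(θ) = J(θ)ᵀ J(θ)` of a residual map `ξ`, where
`J(θ) = Dξ(θ)` is the Fréchet derivative (Jacobian) of `ξ` at `θ`. -/
noncomputable def gnCurvature {p n : ℕ}
    (ξ : EuclideanSpace ℝ (Fin p) → EuclideanSpace ℝ (Fin n))
    (θ : EuclideanSpace ℝ (Fin p)) :
    EuclideanSpace ℝ (Fin p) →L[ℝ] EuclideanSpace ℝ (Fin p) :=
  (ContinuousLinearMap.adjoint (fderiv ℝ ξ θ)).comp (fderiv ℝ ξ θ)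

/-- The damped Gauss–Newton map `T_GN(θ) = θ − γ H(θ)⁻¹ J(θ)ᵀ ξ(θ)`; the inverse is
`Ring.inverse`, which equals the true inverse wherever `H(θ)` is invertible. -/
noncomputable def dampedGN {p n : ℕ}
    (ξ : EuclideanSpace ℝ (Fin p) → EuclideanSpace ℝ (Fin n)) (γ : ℝ)
    (θ : EuclideanSpace ℝ (Fin p)) : EuclideanSpace ℝ (Fin p) :=
  θ - γ • (Ring.inverse (gnCurvature ξ θ)) (ContinuousLinearMap.adjoint (fderiv ℝ ξ θ) (ξ θ))

theorem exists_inv_nat_bound_of_contraction {e : ℕ → ℝ} {ρ ε C : ℝ} (hρ0 : 0 < ρ) (hρ1 : ρ < 1)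
    (hC : 0 < C) (he : ∀ k, 0 ≤ e k) (heε : ∀ k, e k ≤ ε)
    (hstep : ∀ k : ℕ, e (k + 1) ≤ ρ * e k + C / (k + 1)) :
    ∃ C' > (0 : ℝ), ∀ K : ℕ, 1 ≤ K → e K ≤ C' / K + ρ ^ K * e 0 := by
  have hr : 0 < 1 - ρ := by linarith
  obtain ⟨m, hm⟩ := exists_nat_ge (2 * ρ / (1 - ρ))
  rw [div_le_iff₀ hr] at hm
  refine ⟨max (ε * m) (2 * C / (1 - ρ)), lt_max_of_lt_right (by positivity), ?_⟩
  set D := max (ε * m) (2 * C / (1 - ρ))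
  have hD1 : ε * m ≤ D := le_max_left _ _
  have hD2 : 2 * C ≤ D * (1 - ρ) := (div_le_iff₀ hr).1 (le_max_right _ _)
  have hD0 : 0 < D := lt_max_of_lt_right (by positivity)
  have hε : 0 ≤ ε := (he 0).trans (heε 0)
  intro K hK
  induction K, hK using Nat.le_induction with
  | base =>
    have h := hstep 0
    norm_num at h ⊢
    nlinarith
  | succ K hK ih =>
    have hK0 : (0 : ℝ) < K := by exact_mod_cast hK
    push_cast
    by_cases hlt : K + 1 ≤ m
    · have hle : (K : ℝ) + 1 ≤ m := by exact_mod_cast hlt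
      have h1 : ε ≤ D / (K + 1) := by
        rw [le_div_iff₀ (by positivity)]
        exact (mul_le_mul_of_nonneg_left hle hε).trans hD1
      have h2 : 0 ≤ ρ ^ (K + 1) * e 0 := mul_nonneg (by positivity) (he 0)
      linarith [heε (K + 1)]
    · have hle : (m : ℝ) ≤ K := by exact_mod_cast (by omega : m ≤ K)
      have hKρ : 2 * ρ ≤ K * (1 - ρ) := hm.trans (mul_le_mul_of_nonneg_right hle hr.le)
      have h1 : ρ * (D / K) + C / (K + 1) ≤ D / (K + 1) := by
        have : D / (K + 1) - (ρ * (D / K) + C / (K + 1))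
            = (D * (K * (1 - ρ) - 2 * ρ) + K * (D * (1 - ρ) - 2 * C)) / (2 * K * (K + 1)) := by
          field_simp
          ring
        rw [← sub_nonneg, this]
        have := sub_nonneg.2 hKρ
        have := sub_nonneg.2 hD2
        positivity
      calc e (K + 1) ≤ ρ * e K + C / (K + 1) := hstep K
        _ ≤ ρ * (D / K + ρ ^ K * e 0) + C / (K + 1) := by gcongr
        _ = (ρ * (D / K) + C / (K + 1)) + ρ ^ (K + 1) * e 0 := by ring
        _ ≤ D / (K + 1) + ρ ^ (K + 1) * e 0 := by gcongr

theorem isUnit_gnCurvature_of_injective {p n : ℕ}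
    {ξ : EuclideanSpace ℝ (Fin p) → EuclideanSpace ℝ (Fin n)} {θ : EuclideanSpace ℝ (Fin p)}
    (hinj : Function.Injective (fderiv ℝ ξ θ)) : IsUnit (gnCurvature ξ θ) := by
  have hH : Function.Injective (gnCurvature ξ θ) := by
    rw [injective_iff_map_eq_zero]
    intro v hv
    apply (injective_iff_map_eq_zero _).1 hinj
    rw [← inner_self_eq_zero (𝕜 := ℝ), ← adjoint_inner_left]
    change inner ℝ (gnCurvature ξ θ v) v = 0
    rw [hv, inner_zero_left]
  exact ContinuousLinearMap.isUnit_iff_bijective.2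
    ⟨hH, LinearMap.surjective_of_injective (f := (gnCurvature ξ θ).toLinearMap) hH⟩

theorem continuous_gnCurvature {p n : ℕ}
    {ξ : EuclideanSpace ℝ (Fin p) → EuclideanSpace ℝ (Fin n)} (hξ : Continuous (fderiv ℝ ξ)) :
    Continuous (gnCurvature ξ) :=
  (adjoint.continuous.comp hξ).clm_comp hξ

theorem continuousAt_inverse_gnCurvature_comp_adjoint {p n : ℕ}
    {ξ : EuclideanSpace ℝ (Fin p) → EuclideanSpace ℝ (Fin n)} {θ : EuclideanSpace ℝ (Fin p)}
    (hξ : Continuous (fderiv ℝ ξ)) (hH : IsUnit (gnCurvature ξ θ)) :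
    ContinuousAt
      (fun x => (Ring.inverse (gnCurvature ξ x)).comp (adjoint (fderiv ℝ ξ x))) θ := by
  obtain ⟨u, hu⟩ := hH
  have hinv : ContinuousAt (fun x => Ring.inverse (gnCurvature ξ x)) θ := by
    have h := NormedRing.inverse_continuousAt u
    rw [hu] at h
    exact h.comp (continuous_gnCurvature hξ).continuousAt
  exact hinv.clm_comp (adjoint.continuous.comp hξ).continuousAt

theorem dampedGN_sub_eq {p n : ℕ}
    {ξ : EuclideanSpace ℝ (Fin p) → EuclideanSpace ℝ (Fin n)} {θ : EuclideanSpace ℝ (Fin p)}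
    (hH : IsUnit (gnCurvature ξ θ)) (γ : ℝ) (θs : EuclideanSpace ℝ (Fin p)) :
    dampedGN ξ γ θ - θs = (1 - γ) • (θ - θs) -
      γ • (Ring.inverse (gnCurvature ξ θ)).comp (adjoint (fderiv ℝ ξ θ))
        (ξ θ - fderiv ℝ ξ θ (θ - θs)) := by
  have h : Ring.inverse (gnCurvature ξ θ) (adjoint (fderiv ℝ ξ θ) (fderiv ℝ ξ θ (θ - θs)))
      = θ - θs :=
    congrArg (fun A => A (θ - θs)) (Ring.inverse_mul_cancel _ hH)
  rw [comp_apply, map_sub, map_sub, h, dampedGN]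
  module

/-- Near a zero-residual regular solution, the damped Gauss–Newton map contracts towards the
solution with factor `1 - γ / 2`. -/
theorem eventually_norm_dampedGN_sub_le {p n : ℕ}
    {ξ : EuclideanSpace ℝ (Fin p) → EuclideanSpace ℝ (Fin n)} (hξ : ContDiff ℝ 1 ξ)
    {θs : EuclideanSpace ℝ (Fin p)} (hzero : ξ θs = 0) (hH : IsUnit (gnCurvature ξ θs))
    {γ : ℝ} (hγ : γ ∈ Set.Ioo (0 : ℝ) 1) :
    ∀ᶠ θ in nhds θs, IsUnit (gnCurvature ξ θ) ∧
      ‖dampedGN ξ γ θ - θs‖ ≤ (1 - γ / 2) * ‖θ - θs‖ := by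
  have hJ : Continuous (fderiv ℝ ξ) := hξ.continuous_fderiv one_ne_zero
  set P := fun x => (Ring.inverse (gnCurvature ξ x)).comp (adjoint (fderiv ℝ ξ x))
  set M := ‖P θs‖ + 1
  have hM0 : 0 < M := by positivity
  have hδ : 0 < 1 / (4 * M) := by positivity
  have hunit : ∀ᶠ θ in nhds θs, IsUnit (gnCurvature ξ θ) :=
    (continuous_gnCurvature hJ).continuousAt.eventually (Units.isOpen.mem_nhds hH)
  have hPM : ∀ᶠ θ in nhds θs, ‖P θ‖ < M :=
    (continuousAt_inverse_gnCurvature_comp_adjoint hJ hH).norm.eventually_lt_const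
      (lt_add_one _)
  have hlin := (hξ.differentiable one_ne_zero θs).hasFDerivAt.isLittleO.bound hδ
  have hJδ : ∀ᶠ θ in nhds θs, dist (fderiv ℝ ξ θ) (fderiv ℝ ξ θs) < 1 / (4 * M) :=
    hJ.continuousAt.eventually (Metric.ball_mem_nhds _ hδ)
  filter_upwards [hunit, hPM, hlin, hJδ] with θ hu hPθ hl hj
  refine ⟨hu, ?_⟩
  rw [hzero, sub_zero] at hl
  rw [dist_eq_norm] at hj
  have hres : ‖ξ θ - fderiv ℝ ξ θ (θ - θs)‖ ≤ 1 / (2 * M) * ‖θ - θs‖ := by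
    calc ‖ξ θ - fderiv ℝ ξ θ (θ - θs)‖
        = ‖(ξ θ - fderiv ℝ ξ θs (θ - θs)) - (fderiv ℝ ξ θ - fderiv ℝ ξ θs) (θ - θs)‖ := by
          rw [sub_apply]; congr 1; abel
      _ ≤ 1 / (4 * M) * ‖θ - θs‖ + 1 / (4 * M) * ‖θ - θs‖ :=
          (norm_sub_le _ _).trans (add_le_add hl (le_of_opNorm_le _ hj.le _))
      _ = 1 / (2 * M) * ‖θ - θs‖ := by field_simp; ring
  have hPres : ‖P θ (ξ θ - fderiv ℝ ξ θ (θ - θs))‖ ≤ 1 / 2 * ‖θ - θs‖ := by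
    calc ‖P θ (ξ θ - fderiv ℝ ξ θ (θ - θs))‖
        ≤ M * (1 / (2 * M) * ‖θ - θs‖) :=
          (le_of_opNorm_le _ hPθ.le _).trans (mul_le_mul_of_nonneg_left hres hM0.le)
      _ = 1 / 2 * ‖θ - θs‖ := by field_simp
  rw [dampedGN_sub_eq hu]
  calc _ ≤ ‖(1 - γ) • (θ - θs)‖ + ‖γ • P θ (ξ θ - fderiv ℝ ξ θ (θ - θs))‖ := norm_sub_le _ _
    _ = (1 - γ) * ‖θ - θs‖ + γ * ‖P θ (ξ θ - fderiv ℝ ξ θ (θ - θs))‖ := by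
        rw [norm_smul, norm_smul, Real.norm_of_nonneg (by linarith [hγ.2]),
          Real.norm_of_nonneg hγ.1.le]
    _ ≤ (1 - γ) * ‖θ - θs‖ + γ * (1 / 2 * ‖θ - θs‖) := by
        gcongr
        exact hγ.1.le
    _ = (1 - γ / 2) * ‖θ - θs‖ := by ring

/-- End-to-end convergence of inexact damped Gauss–Newton in the
zero-residual regular regime (the paper's Theorem 1): if `ξ` is `C²`, `ξ(θ*) = 0` and
`J(θ*)` is injective, then there are `ε > 0` and `ρ ∈ (0,1)` such that `H(θ)` is
invertible on the closed `ε`-ball `B` around `θ*`, `T_GN` maps `B` into `B`, and every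
sequence in `B` with `‖θ_{k+1} − T_GN(θ_k)‖ ≤ C/(k+1)` satisfies
`‖θ_K − θ*‖ ≤ C'/K + ρ^K ‖θ₀ − θ*‖` for some `C' > 0` and all `K ≥ 1`. -/
theorem inexact_dampedGN_convergence
    (p n : ℕ) (hp : 0 < p) (hn : 0 < n)
    (ξ : EuclideanSpace ℝ (Fin p) → EuclideanSpace ℝ (Fin n))
    (hξ : ContDiff ℝ 2 ξ)
    (θs : EuclideanSpace ℝ (Fin p))
    (hzero : ξ θs = 0)
    (hinj : Function.Injective (fderiv ℝ ξ θs))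
    (γ : ℝ) (hγ : γ ∈ Set.Ioo (0 : ℝ) 1) :
    ∃ ε > (0 : ℝ), ∃ ρ ∈ Set.Ioo (0 : ℝ) 1,
      (∀ θ ∈ Metric.closedBall θs ε, IsUnit (gnCurvature ξ θ)) ∧
      (∀ θ ∈ Metric.closedBall θs ε, dampedGN ξ γ θ ∈ Metric.closedBall θs ε) ∧
      ∀ C > (0 : ℝ), ∀ θseq : ℕ → EuclideanSpace ℝ (Fin p),
        (∀ k : ℕ, θseq k ∈ Metric.closedBall θs ε) →
        (∀ k : ℕ, ‖θseq (k + 1) - dampedGN ξ γ (θseq k)‖ ≤ C / (k + 1)) →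
        ∃ C' > (0 : ℝ), ∀ K : ℕ, 1 ≤ K →
          ‖θseq K - θs‖ ≤ C' / K + ρ ^ K * ‖θseq 0 - θs‖ := by
  obtain ⟨hγ0, hγ1⟩ := hγ
  obtain ⟨ε, hε, hB⟩ := Metric.nhds_basis_closedBall.eventually_iff.1
    (eventually_norm_dampedGN_sub_le (hξ.of_le one_le_two) hzero
      (isUnit_gnCurvature_of_injective hinj) ⟨hγ0, hγ1⟩)
  refine ⟨ε, hε, 1 - γ / 2, ⟨by linarith, by linarith⟩, fun θ hθ => (hB hθ).1, ?_, ?_⟩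
  · intro θ hθ
    have h := (hB hθ).2
    rw [mem_closedBall_iff_norm] at hθ ⊢
    nlinarith [norm_nonneg (θ - θs)]
  · intro C hC θseq hmem hstep
    refine exists_inv_nat_bound_of_contraction (e := fun k => ‖θseq k - θs‖) (by linarith)
      (by linarith) hC (fun k => norm_nonneg _) (fun k => mem_closedBall_iff_norm.1 (hmem k))
      fun k => ?_
    calc ‖θseq (k + 1) - θs‖
        ≤ ‖θseq (k + 1) - dampedGN ξ γ (θseq k)‖ + ‖dampedGN ξ γ (θseq k) - θs‖ :=
          norm_sub_le_norm_sub_add_norm_sub _ _ _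
      _ ≤ (1 - γ / 2) * ‖θseq k - θs‖ + C / (k + 1) := by
          linarith [hstep k, (hB (hmem k)).2]
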